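/- Assume p is q²-separable of degree n ≥ 1, q is not a root of unity, and α₀, α₋, α₊ are nonzero. Write the monic polynomial associated to p as p̂(z) = zⁿ − Σ_{i=0}^{n−1} μᵢzⁱ, and let [l] := (1 − q^{2l})/(1 − q²) denote the q²-integers. Then the integral satisfies, for all k ∈ ℕ, the recurrence [n+k+1]·Λ(z^{n+k}) = Σ_{i=0}^{n−1} [i+k+1]·μᵢ·Λ(z^{k+i}) in coker(div), where z = z₋z₊. -/

import Mathlib

noncomputable section

open Polynomial
open scoped Classical

namespace GWAPaper

variable (K : Type) [Field K]

/-- Defining relations of the generalized Weyl algebra `A(p;q)`; the generators are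
indexed by `Fin 4` with `0 ↦ x₊`, `1 ↦ x₋`, `2 ↦ z₊`, `3 ↦ z₋`. -/
inductive GWARel (q : K) (p : K[X]) :
    FreeAlgebra K (Fin 4) → FreeAlgebra K (Fin 4) → Prop
  | zz : GWARel q p (FreeAlgebra.ι K (2 : Fin 4) * FreeAlgebra.ι K (3 : Fin 4))
      (FreeAlgebra.ι K (3 : Fin 4) * FreeAlgebra.ι K (2 : Fin 4))
  | xpzp : GWARel q p (FreeAlgebra.ι K (0 : Fin 4) * FreeAlgebra.ι K (2 : Fin 4))
      (q⁻¹ • (FreeAlgebra.ι K (2 : Fin 4) * FreeAlgebra.ι K (0 : Fin 4)))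
  | xpzm : GWARel q p (FreeAlgebra.ι K (0 : Fin 4) * FreeAlgebra.ι K (3 : Fin 4))
      (q⁻¹ • (FreeAlgebra.ι K (3 : Fin 4) * FreeAlgebra.ι K (0 : Fin 4)))
  | xmzp : GWARel q p (FreeAlgebra.ι K (1 : Fin 4) * FreeAlgebra.ι K (2 : Fin 4))
      (q • (FreeAlgebra.ι K (2 : Fin 4) * FreeAlgebra.ι K (1 : Fin 4)))
  | xmzm : GWARel q p (FreeAlgebra.ι K (1 : Fin 4) * FreeAlgebra.ι K (3 : Fin 4))
      (q • (FreeAlgebra.ι K (3 : Fin 4) * FreeAlgebra.ι K (1 : Fin 4)))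
  | xpxm : GWARel q p (FreeAlgebra.ι K (0 : Fin 4) * FreeAlgebra.ι K (1 : Fin 4))
      (Polynomial.aeval (FreeAlgebra.ι K (2 : Fin 4) * FreeAlgebra.ι K (3 : Fin 4)) p)
  | xmxp : GWARel q p (FreeAlgebra.ι K (1 : Fin 4) * FreeAlgebra.ι K (0 : Fin 4))
      (Polynomial.aeval ((q ^ 2 : K) • (FreeAlgebra.ι K (3 : Fin 4) * FreeAlgebra.ι K (2 : Fin 4))) p)

/-- The generalized Weyl algebra `A(p;q)`. -/
abbrev GWA (q : K) (p : K[X]) : Type := RingQuot (GWARel K q p)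

/-- The images of the four generators in `A(p;q)`. -/
def gwaGen (q : K) (p : K[X]) (i : Fin 4) : GWA K q p :=
  RingQuot.mkAlgHom K (GWARel K q p) (FreeAlgebra.ι K i)

/-- The generator `x₊`. -/
def xp (q : K) (p : K[X]) : GWA K q p := gwaGen K q p 0
/-- The generator `x₋`. -/
def xm (q : K) (p : K[X]) : GWA K q p := gwaGen K q p 1
/-- The generator `z₊`. -/
def zp (q : K) (p : K[X]) : GWA K q p := gwaGen K q p 2
/-- The generator `z₋`. -/
def zm (q : K) (p : K[X]) : GWA K q p := gwaGen K q p 3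

/-- ℤ-degrees of the generators: `deg x₊ = deg z₊ = 1`, `deg x₋ = deg z₋ = -1`. -/
def gwaWt : Fin 4 → ℤ := ![1, -1, 1, -1]

/-- The total degree of a word in the generators. -/
def wordDeg (w : List (Fin 4)) : ℤ := (w.map gwaWt).sum

/-- The product in `A(p;q)` of the letters of a word. -/
def wordVal (q : K) (p : K[X]) (w : List (Fin 4)) : GWA K q p :=
  (w.map (gwaGen K q p)).prod

/-- The degree-`n` homogeneous component of the ℤ-graded algebra `A(p;q)`:
the `K`-linear span of the values of all words of total degree `n`. -/
def component (q : K) (p : K[X]) (n : ℤ) : Submodule K (GWA K q p) :=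
  Submodule.span K {a | ∃ w : List (Fin 4), wordDeg w = n ∧ wordVal K q p w = a}

/-- The `q²`-derivative `p_{q²}` of a polynomial `p`, equal to
`(p(q²z) - p(z))/((q²-1)z)` if `q² ≠ 1` and to `p'` if `q² = 1`. -/
def qDeriv (q : K) (p : K[X]) : K[X] :=
  if q ^ 2 = 1 then derivative p
  else (p.comp (C (q ^ 2) * X) - p) / (C (q ^ 2 - 1) * X)

/-- The polynomial `c(z) = q·p_{q²}(z)`. -/
def cPoly (q : K) (p : K[X]) : K[X] := C q * qDeriv K q p

/-- `p` is `q²`-separable: `p(z)` is coprime with `z·p_{q²}(z)`. -/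
def QSeparable (q : K) (p : K[X]) : Prop := IsCoprime p (X * qDeriv K q p)

/-- The right `A(p;q)`-action on the free left module `Ω = A(p;q)³` with basis
`ω₋, ω₀, ω₊` (coordinates `0, 1, 2`), twisted by the automorphisms `σ₋ = σ₊` and `σ₀`:
`ω₋·a = σ₋(a)·ω₋`, `ω₀·a = σ₀(a)·ω₀`, `ω₊·a = σ₊(a)·ω₊`. -/
def rAct (q : K) (p : K[X]) (σm σ0 : GWA K q p ≃ₐ[K] GWA K q p)
    (ω : Fin 3 → GWA K q p) (a : GWA K q p) : Fin 3 → GWA K q p :=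
  ![ω 0 * σm a, ω 1 * σ0 a, ω 2 * σm a]

/-- A right `A(p;q)`-module map `Ω → A(p;q)`, where `Ω` is the free left module
with basis `ω₋, ω₀, ω₊` and right action `rAct`. -/
structure OmegaRightHom (q : K) (p : K[X]) (σm σ0 : GWA K q p ≃ₐ[K] GWA K q p) : Type where
  toFun : (Fin 3 → GWA K q p) → GWA K q p
  map_add' : ∀ ω η, toFun (ω + η) = toFun ω + toFun η
  map_rmul' : ∀ ω a, toFun (rAct K q p σm σ0 ω a) = toFun ω * a

/-- The divergence associated with the calculus `(Ω, d)`: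
`div(ξ) = q⁻²·∂₋(ξ(ω₋)) + ∂₀(ξ(ω₀)) + q²·∂₊(ξ(ω₊))`. -/
def divMap (q : K) (p : K[X]) (σm σ0 : GWA K q p ≃ₐ[K] GWA K q p)
    (D0 Dm Dp : GWA K q p →ₗ[K] GWA K q p) (ξ : OmegaRightHom K q p σm σ0) : GWA K q p :=
  q ^ (-2 : ℤ) • Dm (ξ.toFun ![1, 0, 0]) + D0 (ξ.toFun ![0, 1, 0]) + q ^ 2 • Dp (ξ.toFun ![0, 0, 1])

/-- The image of the divergence, as a `K`-subspace of `A(p;q)`. -/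
def imDiv (q : K) (p : K[X]) (σm σ0 : GWA K q p ≃ₐ[K] GWA K q p)
    (D0 Dm Dp : GWA K q p →ₗ[K] GWA K q p) : Submodule K (GWA K q p) :=
  Submodule.span K (Set.range (divMap K q p σm σ0 D0 Dm Dp))


lemma mul_qDeriv {q : K} (hq2 : q ^ 2 ≠ 1) (p : K[X]) :
    C (q ^ 2 - 1) * X * qDeriv K q p = p.comp (C (q ^ 2) * X) - p := by
  have hc : q ^ 2 - 1 ≠ 0 := sub_ne_zero.mpr hq2
  have hdvd : C (q ^ 2 - 1) * X ∣ p.comp (C (q ^ 2) * X) - p := by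
    rw [(isUnit_C.mpr hc.isUnit).mul_left_dvd, X_dvd_iff]
    simp [coeff_zero_eq_eval_zero]
  rw [qDeriv, if_neg hq2]
  exact EuclideanDomain.mul_div_cancel' (mul_ne_zero (C_ne_zero.mpr hc) X_ne_zero) hdvd

section SkewDerivation

variable {K} {A : Type*} [Ring A] [Algebra K A]

lemma mul_pow_of_skew_commute {x Z : A} {r : K} (h : x * Z = r • (Z * x)) (k : ℕ) :
    x * Z ^ k = r ^ k • (Z ^ k * x) := by
  induction k with
  | zero => simp
  | succ k ih =>
    rw [pow_succ, ← mul_assoc, ih, smul_mul_assoc, mul_assoc, h, mul_smul_comm, smul_smul,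
      ← mul_assoc, ← pow_succ]

/-- The value of a skew derivation `D` with `D x₊ = D z₊ = 0` on `zᵏ z₋ x₋`. -/
lemma skewDerivation_apply {q : K} (hq : q ≠ 0) (hq2 : q ^ 2 ≠ 1) (p : K[X]) {a : K}
    {xp xm zp zm : A} (hzz : zp * zm = zm * zp)
    (hxpzp : xp * zp = q⁻¹ • (zp * xp)) (hxpzm : xp * zm = q⁻¹ • (zm * xp))
    (hxpxm : xp * xm = aeval (zp * zm) p)
    {σ : A ≃ₐ[K] A} {D : A →ₗ[K] A} (hD : ∀ u v, D (u * v) = D u * σ v + u * D v)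
    (hσzp : σ zp = q • zp) (hσzm : σ zm = q⁻¹ • zm) (hσxm : σ xm = q⁻¹ • xm)
    (hDzp : D zp = 0) (hDzm : D zm = a • xp)
    (hDxm : D xm = a • (aeval (zp * zm) (cPoly K q p) * zp)) (k : ℕ) :
    ((q ^ 2 - 1) * q ^ (2 * k + 1)) • D ((zp * zm) ^ k * (zm * xm)) =
      a • aeval (zp * zm)
        (X ^ k * (C (q ^ (2 * k + 2)) * p.comp (C (q ^ 2) * X) - p)) := by
  have hzpZ : zp * (zp * zm) = zp * zm * zp := by rw [mul_assoc, ← hzz]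
  have hzmZ : zm * (zp * zm) = zp * zm * zm := by rw [hzz, mul_assoc, hzz]
  have hxpZ : xp * (zp * zm) = (q⁻¹ * q⁻¹) • (zp * zm * xp) := by
    rw [← mul_assoc, hxpzp, smul_mul_assoc, mul_assoc, hxpzm, mul_smul_comm, smul_smul, mul_assoc]
  have hσZ : σ (zp * zm) = zp * zm := by
    rw [map_mul, hσzp, hσzm, smul_mul_smul_comm, mul_inv_cancel₀ hq, one_smul]
  have hDZ : D (zp * zm) = a • (zp * xp) := by
    rw [hD, hDzp, hDzm, zero_mul, zero_add, mul_smul_comm]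
  generalize hZ : zp * zm = Z at hxpxm hDxm hzpZ hzmZ hxpZ hσZ hDZ ⊢
  have hCqDeriv : C q ^ 2 * X * qDeriv K q p - X * qDeriv K q p =
      p.comp (C (q ^ 2) * X) - p := by
    rw [← mul_qDeriv K hq2, C_sub, C_1, C_pow]
    ring
  have hCinv : C q * C q⁻¹ = 1 := by rw [← C_mul, mul_inv_cancel₀ hq, C_1]
  induction k with
  | zero =>
    have hzm : zm * aeval Z (cPoly K q p) = aeval Z (cPoly K q p) * zm :=
      (Algebra.commute_of_mem_adjoin_singleton_of_commute (R := K)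
        (aeval_mem_adjoin_singleton K Z) (show Commute zm Z from hzmZ)).eq
    have hval : D (zm * xm) = a • aeval Z (C q⁻¹ * p + cPoly K q p * X) := by
      rw [hD, hDzm, hσxm, hDxm, smul_mul_smul_comm, hxpxm, mul_smul_comm, ← mul_assoc, hzm,
        mul_assoc, ← hzz, hZ, map_add, map_mul, map_mul, aeval_C, aeval_X, smul_add, mul_smul,
        Algebra.smul_def q⁻¹]
    rw [pow_zero, one_mul, hval, smul_comm, ← map_smul (aeval Z)]
    congr 2
    rw [cPoly, pow_zero, one_mul, smul_eq_C_mul]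
    generalize p.comp (C (q ^ 2) * X) = r at *
    simp only [C_mul, C_pow, C_sub, C_1, mul_zero, zero_add, pow_one]
    linear_combination (C q ^ 2) * hCqDeriv + (C q ^ 2 - 1) * p * hCinv
  | succ k ih =>
    have hxpow : xp * Z ^ k = (q⁻¹ * q⁻¹) ^ k • (Z ^ k * xp) := mul_pow_of_skew_commute hxpZ k
    have hzpow : zp * Z ^ k = Z ^ k * zp := (show Commute zp Z from hzpZ).pow_right k
    have hσ : σ (Z ^ k * (zm * xm)) = (q⁻¹ * q⁻¹) • (Z ^ k * (zm * xm)) := by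
      rw [map_mul, map_pow, map_mul, hσZ, hσzm, hσxm, smul_mul_smul_comm, mul_smul_comm]
    have hprod : zp * xp * (Z ^ k * (zm * xm)) =
        ((q⁻¹ * q⁻¹) ^ k * q⁻¹) • aeval Z (X ^ (k + 1) * p) := by
      calc zp * xp * (Z ^ k * (zm * xm)) = zp * (xp * Z ^ k) * (zm * xm) := by
            simp only [mul_assoc]
        _ = (q⁻¹ * q⁻¹) ^ k • (zp * Z ^ k * (xp * zm) * xm) := by
            simp only [hxpow, mul_assoc, mul_smul_comm, smul_mul_assoc]
        _ = ((q⁻¹ * q⁻¹) ^ k * q⁻¹) • (Z ^ k * (zp * zm) * (xp * xm)) := by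
            simp only [hzpow, hxpzm, mul_assoc, mul_smul_comm, smul_mul_assoc, mul_smul]
        _ = _ := by
            rw [hZ, ← pow_succ, hxpxm, map_mul, map_pow, aeval_X]
    have hD' : D (Z ^ (k + 1) * (zm * xm)) =
        a • ((q⁻¹ * q⁻¹) * ((q⁻¹ * q⁻¹) ^ k * q⁻¹)) • aeval Z (X ^ (k + 1) * p) +
          Z * D (Z ^ k * (zm * xm)) := by
      rw [pow_succ', mul_assoc, hD, hDZ, hσ, smul_mul_assoc, mul_smul_comm, hprod, smul_smul (q⁻¹ * q⁻¹)]
    have hscal : (q ^ 2 - 1) * q ^ (2 * (k + 1) + 1) *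
        ((q⁻¹ * q⁻¹) * ((q⁻¹ * q⁻¹) ^ k * q⁻¹)) = q ^ 2 - 1 := by
      rw [← pow_two, ← pow_mul, inv_pow, inv_pow]
      field_simp
      ring
    rw [hD', smul_add, smul_comm _ a, smul_smul _ (q⁻¹ * q⁻¹ * _), hscal, ← mul_smul_comm,
      show (q ^ 2 - 1) * q ^ (2 * (k + 1) + 1) = q ^ 2 * ((q ^ 2 - 1) * q ^ (2 * k + 1)) by ring,
      mul_smul (q ^ 2), ih, smul_comm _ a, mul_smul_comm, ← smul_add]
    congr 1
    rw [← map_smul, ← map_smul]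
    nth_rw 2 [← aeval_X (R := K) Z]
    rw [← map_mul, ← map_add]
    congr 1
    simp only [smul_eq_C_mul, C_pow, C_sub, C_1]
    ring

end SkewDerivation

lemma mem_imDiv_of_left (q : K) (hq : q ≠ 0) (p : K[X]) (σm σ0 : GWA K q p ≃ₐ[K] GWA K q p)
    (D0 Dm Dp : GWA K q p →ₗ[K] GWA K q p) (b : GWA K q p) :
    Dm b ∈ imDiv K q p σm σ0 D0 Dm Dp := by
  let ξ : OmegaRightHom K q p σm σ0 :=
    { toFun := fun ω ↦ b * σm.symm (ω 0)
      map_add' := fun ω η ↦ by simp [mul_add]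
      map_rmul' := fun ω a ↦ by simp [rAct, mul_assoc] }
  have hξ : divMap K q p σm σ0 D0 Dm Dp ξ = q ^ (-2 : ℤ) • Dm b := by
    simp [divMap, ξ]
  have hmem : q ^ (-2 : ℤ) • Dm b ∈ imDiv K q p σm σ0 D0 Dm Dp :=
    hξ ▸ Submodule.subset_span ⟨ξ, rfl⟩
  exact (Submodule.smul_mem_iff _ (zpow_ne_zero _ hq)).mp hmem

lemma gwaGen_mem_component (q : K) (p : K[X]) (i : Fin 4) :
    gwaGen K q p i ∈ component K q p (gwaWt i) :=
  Submodule.subset_span ⟨[i], by simp [wordDeg], by simp [wordVal]⟩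

lemma zp_mul_zm (q : K) (p : K[X]) : zp K q p * zm K q p = zm K q p * zp K q p := by
  simpa [zp, zm, gwaGen] using RingQuot.mkAlgHom_rel K (GWARel.zz (q := q) (p := p))

lemma xp_mul_zp (q : K) (p : K[X]) :
    xp K q p * zp K q p = q⁻¹ • (zp K q p * xp K q p) := by
  simpa [zp, xp, gwaGen] using RingQuot.mkAlgHom_rel K (GWARel.xpzp (q := q) (p := p))

lemma xp_mul_zm (q : K) (p : K[X]) :
    xp K q p * zm K q p = q⁻¹ • (zm K q p * xp K q p) := by
  simpa [zm, xp, gwaGen] using RingQuot.mkAlgHom_rel K (GWARel.xpzm (q := q) (p := p))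

lemma xp_mul_xm (q : K) (p : K[X]) :
    xp K q p * xm K q p = aeval (zp K q p * zm K q p) p := by
  simpa [zp, zm, xp, xm, gwaGen, ← aeval_algHom_apply] using
    RingQuot.mkAlgHom_rel K (GWARel.xpxm (q := q) (p := p))

/-- The recurrence for the integral: writing the monic polynomial
associated to `p` as `p̂(z) = zⁿ − Σ μᵢzⁱ` and `[l] = (1−q^{2l})/(1−q²)`, one has
`[n+k+1]·Λ(z^{n+k}) = Σ_{i<n} [i+k+1]·μᵢ·Λ(z^{k+i})` for all `k ∈ ℕ`. -/
theorem integral_recurrence [CharZero K]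
    (q : K) (hq : q ≠ 0) (p : K[X])
    (α0 αm αp : K)
    (σm : GWA K q p ≃ₐ[K] GWA K q p)
    (hσm : ∀ (n : ℤ) (a : GWA K q p), a ∈ component K q p n → σm a = q ^ n • a)
    (σ0 : GWA K q p ≃ₐ[K] GWA K q p)
    (hσ0 : ∀ (n : ℤ) (a : GWA K q p), a ∈ component K q p n → σ0 a = q ^ (2 * n) • a)
    (D0 Dm Dp : GWA K q p →ₗ[K] GWA K q p)
    (hD0leib : ∀ a b, D0 (a * b) = D0 a * σ0 b + a * D0 b)
    (hD0xp : D0 (xp K q p) = α0 • xp K q p)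
    (hD0xm : D0 (xm K q p) = -(q ^ (-2 : ℤ) * α0) • xm K q p)
    (hD0zp : D0 (zp K q p) = α0 • zp K q p)
    (hD0zm : D0 (zm K q p) = -(q ^ (-2 : ℤ) * α0) • zm K q p)
    (hDmleib : ∀ a b, Dm (a * b) = Dm a * σm b + a * Dm b)
    (hDmxp : Dm (xp K q p) = 0)
    (hDmzp : Dm (zp K q p) = 0)
    (hDmxm : Dm (xm K q p) = αm • (aeval (zp K q p * zm K q p) (cPoly K q p) * zp K q p))
    (hDmzm : Dm (zm K q p) = αm • xp K q p)
    (hDpleib : ∀ a b, Dp (a * b) = Dp a * σm b + a * Dp b)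
    (hDpxm : Dp (xm K q p) = 0)
    (hDpzm : Dp (zm K q p) = 0)
    (hDpxp : Dp (xp K q p) = αp • (aeval (zp K q p * zm K q p) (cPoly K q p) * zm K q p))
    (hDpzp : Dp (zp K q p) = αp • xm K q p)
    (hsep : QSeparable K q p)
    (hqru : ∀ n : ℕ, q ^ n = 1 → n = 0)
    (hα0 : α0 ≠ 0) (hαm : αm ≠ 0) (hαp : αp ≠ 0)
    (hdeg : 1 ≤ p.natDegree) :
    ∀ k : ℕ,
      ((1 - q ^ (2 * (p.natDegree + k + 1))) / (1 - q ^ 2)) •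
          (imDiv K q p σm σ0 D0 Dm Dp).mkQ ((zm K q p * zp K q p) ^ (p.natDegree + k))
        = ∑ i ∈ Finset.range p.natDegree,
            (((1 - q ^ (2 * (i + k + 1))) / (1 - q ^ 2)) *
                (-((C p.leadingCoeff⁻¹ * p).coeff i))) •
              (imDiv K q p σm σ0 D0 Dm Dp).mkQ ((zm K q p * zp K q p) ^ (k + i)) := by
  have hq2 : q ^ 2 ≠ 1 := fun h ↦ two_ne_zero (hqru 2 h)
  have hσ : ∀ i, σm (gwaGen K q p i) = q ^ gwaWt i • gwaGen K q p i := fun i ↦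
    hσm _ _ (gwaGen_mem_component K q p i)
  intro k
  have key := skewDerivation_apply hq hq2 p (zp_mul_zm K q p) (xp_mul_zp K q p) (xp_mul_zm K q p)
    (xp_mul_xm K q p) hDmleib (by simpa [gwaWt, zp] using hσ 2) (by simpa [gwaWt, zm] using hσ 3)
    (by simpa [gwaWt, xm] using hσ 1) hDmzp hDmzm hDmxm k
  have hmem := (imDiv K q p σm σ0 D0 Dm Dp).smul_mem ((q ^ 2 - 1) * q ^ (2 * k + 1))
    (mem_imDiv_of_left K q hq p σm σ0 D0 Dm Dp ((zp K q p * zm K q p) ^ k * (zm K q p * xm K q p)))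
  rw [key, Submodule.smul_mem_iff _ hαm, zp_mul_zm] at hmem
  set Z := zm K q p * zp K q p
  have hsum : aeval Z (X ^ k * (C (q ^ (2 * k + 2)) * p.comp (C (q ^ 2) * X) - p)) =
      ∑ i ∈ Finset.range (p.natDegree + 1),
        ((q ^ (2 * (i + k + 1)) - 1) * p.coeff i) • Z ^ (k + i) := by
    have hcomp : C (q ^ (2 * k + 2)) * p.comp (C (q ^ 2) * X) - p =
        ∑ i ∈ Finset.range (p.natDegree + 1),
          C ((q ^ (2 * (i + k + 1)) - 1) * p.coeff i) * X ^ i := by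
      conv_lhs => rw [p.as_sum_range_C_mul_X_pow]
      rw [Polynomial.sum_comp, Finset.mul_sum, ← Finset.sum_sub_distrib]
      refine Finset.sum_congr rfl fun i _ ↦ ?_
      simp only [mul_comp, C_comp, X_pow_comp, C_mul, C_sub, C_pow, C_1]
      ring
    rw [hcomp, Finset.mul_sum, map_sum]
    refine Finset.sum_congr rfl fun i _ ↦ ?_
    rw [mul_left_comm, ← pow_add, map_mul, aeval_C, map_pow, aeval_X, ← Algebra.smul_def]
  have hzero := (Submodule.Quotient.mk_eq_zero _).mpr hmem
  rw [← Submodule.mkQ_apply, hsum, map_sum, Finset.sum_range_succ] at hzero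
  simp only [map_smul] at hzero
  have hlc : p.leadingCoeff ≠ 0 := leadingCoeff_ne_zero.mpr (by rintro rfl; simp at hdeg)
  have hq2' : 1 - q ^ 2 ≠ 0 := sub_ne_zero.mpr hq2.symm
  have hlast := congrArg (fun v ↦ (-(p.leadingCoeff⁻¹ / (1 - q ^ 2))) • v)
    (eq_neg_of_add_eq_zero_right hzero)
  rw [add_comm k] at hlast
  simp only [smul_neg, Finset.smul_sum, smul_smul, coeff_natDegree] at hlast
  convert hlast using 1
  · congr 1
    field_simp
    ring
  · rw [← Finset.sum_neg_distrib]
    refine Finset.sum_congr rfl fun i _ ↦ ?_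
    rw [← neg_smul, coeff_C_mul]
    congr 1
    ring

end GWAPaper
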